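/- Suppose only that the kernel s satisfies the two integrability bounds sup_{k∈X₁} ∫_{X₂} s(k,q) dπ₂(q) < ∞ and sup_{q∈X₂} ∫_{X₁} s(k,q) dπ₁(k) < ∞. Then there exists exactly one function m : ℍ → B₁ such that for every ζ ∈ ℍ: m(ζ)(k) ≠ 0 for all k ∈ X₁, 1 + (Sᵗ m(ζ))(q) ≠ 0 for all q ∈ X₂, the Dyson equation −1/m(ζ) = ζ − S(1/(1 + Sᵗ m(ζ))) holds pointwise on X₁, and Im m(ζ)(k) > 0 for all k ∈ X₁. Moreover, this function m : ℍ → B₁ is analytic. -/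

import Mathlib

open MeasureTheory
open scoped ENNReal
open Filter Topology

theorem lp_algebraMap_apply {X : Type*} (z : ℂ) (x : X) :
    (algebraMap ℂ (lp (fun _ : X => ℂ) ∞) z : X → ℂ) x = z := by
  rw [Algebra.algebraMap_eq_smul_one, lp.coeFn_smul, lp.infty_coeFn_one]
  simp

/-- The Banach algebra of bounded measurable complex-valued functions, with the supremum norm. -/
def boundedMeasurableSubalgebra (X : Type*) [MeasurableSpace X] :
    Subalgebra ℂ (lp (fun _ : X => ℂ) ∞) where
  carrier := {f | Measurable (f : X → ℂ)}
  mul_mem' {f g} hf hg := by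
    rw [Set.mem_ofPred_eq, lp.infty_coeFn_mul]
    exact Measurable.mul hf hg
  add_mem' {f g} hf hg := by
    rw [Set.mem_ofPred_eq, lp.coeFn_add]
    exact Measurable.add hf hg
  algebraMap_mem' z := by
    rw [Set.mem_ofPred_eq, funext (lp_algebraMap_apply z)]
    exact measurable_const

/-- The type of bounded measurable complex-valued functions. -/
def BoundedMeasurable (X : Type*) [MeasurableSpace X] : Type _ := boundedMeasurableSubalgebra X

namespace BoundedMeasurable

variable {X : Type*} [MeasurableSpace X]

noncomputable instance : NormedCommRing (BoundedMeasurable X) :=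
  inferInstanceAs (NormedCommRing (boundedMeasurableSubalgebra X))

noncomputable instance : NormedAlgebra ℂ (BoundedMeasurable X) :=
  inferInstanceAs (NormedAlgebra ℂ (boundedMeasurableSubalgebra X))

/-- The inclusion into the space of all bounded functions. -/
noncomputable def toLp : BoundedMeasurable X →L[ℂ] lp (fun _ : X => ℂ) ∞ :=
  LinearMap.mkContinuous
    { toFun := Subtype.val
      map_add' := fun _ _ => rfl
      map_smul' := fun _ _ => rfl }
    1 fun u => (one_mul ‖u‖).ge

theorem measurable_coe (u : BoundedMeasurable X) : Measurable (u.1 : X → ℂ) := u.2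

@[simp] theorem coe_one_apply (x : X) : (1 : BoundedMeasurable X).1 x = 1 := rfl

@[simp] theorem coe_add_apply (u v : BoundedMeasurable X) (x : X) :
    (u + v).1 x = u.1 x + v.1 x := rfl

@[simp] theorem coe_sub_apply (u v : BoundedMeasurable X) (x : X) :
    (u - v).1 x = u.1 x - v.1 x := rfl

@[simp] theorem coe_neg_apply (u : BoundedMeasurable X) (x : X) : (-u).1 x = -u.1 x := rfl

@[simp] theorem coe_mul_apply (u v : BoundedMeasurable X) (x : X) :
    (u * v).1 x = u.1 x * v.1 x := rfl

@[simp] theorem coe_algebraMap_apply (z : ℂ) (x : X) :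
    (algebraMap ℂ (BoundedMeasurable X) z).1 x = z :=
  lp_algebraMap_apply z x

theorem norm_apply_le (u : BoundedMeasurable X) (x : X) : ‖u.1 x‖ ≤ ‖u‖ :=
  lp.norm_apply_le_norm ENNReal.top_ne_zero u.1 x

theorem norm_le_of_forall {u : BoundedMeasurable X} {C : ℝ} (hC : 0 ≤ C)
    (h : ∀ x, ‖u.1 x‖ ≤ C) : ‖u‖ ≤ C :=
  lp.norm_le_of_forall_le hC h

theorem ext_apply {u v : BoundedMeasurable X} (h : ∀ x, u.1 x = v.1 x) : u = v :=
  Subtype.ext (lp.ext (funext h))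

/-- A bounded measurable function as an element of the Banach algebra. -/
def ofBounded (f : X → ℂ) (hf : Measurable f) (hb : ∃ C : ℝ, ∀ x, ‖f x‖ ≤ C) :
    BoundedMeasurable X :=
  ⟨⟨f, memℓp_infty (hb.imp fun _ h => Set.forall_mem_range.2 h)⟩, hf⟩

@[simp] theorem ofBounded_apply (f : X → ℂ) (hf : Measurable f) (hb : ∃ C : ℝ, ∀ x, ‖f x‖ ≤ C)
    (x : X) : (ofBounded f hf hb).1 x = f x := rfl

omit [MeasurableSpace X] in
theorem tendsto_apply {ι : Type*} {l : Filter ι} {F : ι → lp (fun _ : X => ℂ) ∞}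
    {f : lp (fun _ : X => ℂ) ∞} (h : Tendsto F l (𝓝 f)) (x : X) :
    Tendsto (fun n => F n x) l (𝓝 (f x)) :=
  tendsto_pi_nhds.1 ((lp.uniformContinuous_coe (E := fun _ : X => ℂ)
    (p := ∞)).continuous.tendsto f |>.comp h) x

theorem isClosed : IsClosed (boundedMeasurableSubalgebra X : Set (lp (fun _ : X => ℂ) ∞)) := by
  refine IsSeqClosed.isClosed fun F f hF hf => ?_
  exact measurable_of_tendsto_metrizable hF
    (tendsto_pi_nhds.2 fun x => tendsto_apply hf x)

instance : CompleteSpace (BoundedMeasurable X) :=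
  (isClosed (X := X)).completeSpace_coe

theorem isUnit_of_le_norm {u : BoundedMeasurable X} {c : ℝ} (hc : 0 < c)
    (h : ∀ x, c ≤ ‖u.1 x‖) : IsUnit u := by
  refine IsUnit.of_mul_eq_one (ofBounded (fun x => (u.1 x)⁻¹) (measurable_coe u).inv
    ⟨c⁻¹, fun x => ?_⟩) (ext_apply fun x => ?_)
  · rw [norm_inv]
    exact inv_anti₀ hc (h x)
  · have : u.1 x ≠ 0 := norm_pos_iff.1 (hc.trans_le (h x))
    simp [this]

theorem ringInverse_apply {u : BoundedMeasurable X} (hu : IsUnit u) (x : X) :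
    (Ring.inverse u).1 x = (u.1 x)⁻¹ := by
  refine eq_inv_of_mul_eq_one_right ?_
  rw [← coe_mul_apply, Ring.mul_inverse_cancel u hu, coe_one_apply]

end BoundedMeasurable

open BoundedMeasurable

/-- A nonnegative measurable kernel whose integrals over the second variable are bounded. -/
structure IsBoundedKernel {X Y : Type*} [MeasurableSpace X] [MeasurableSpace Y] (μ : Measure X)
    (κ : Y → X → ℝ) (C : ℝ) : Prop where
  measurable : Measurable (Function.uncurry κ)
  nonneg : ∀ y x, 0 ≤ κ y x
  bound_nonneg : 0 ≤ C
  integrable : ∀ y, Integrable (κ y) μ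
  integral_le : ∀ y, ∫ x, κ y x ∂μ ≤ C

theorem exists_isBoundedKernel {X Y : Type*} [MeasurableSpace X] [MeasurableSpace Y]
    {μ : Measure X} {κ : Y → X → ℝ} (hm : Measurable (Function.uncurry κ))
    (h0 : ∀ y x, 0 ≤ κ y x)
    (hC : ∃ C : ℝ≥0∞, C < ⊤ ∧ ∀ y, ∫⁻ x, ENNReal.ofReal (κ y x) ∂μ ≤ C) :
    ∃ C, IsBoundedKernel μ κ C := by
  obtain ⟨C, hC, h⟩ := hC
  have hmy (y : Y) : Measurable (κ y) := hm.comp measurable_prodMk_left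
  refine ⟨C.toReal, hm, h0, ENNReal.toReal_nonneg, fun y => ?_, fun y => ?_⟩
  · refine ⟨(hmy y).aestronglyMeasurable, ?_⟩
    rw [hasFiniteIntegral_iff_ofReal (ae_of_all _ (h0 y))]
    exact (h y).trans_lt hC
  · rw [integral_eq_lintegral_of_nonneg_ae (ae_of_all _ (h0 y)) (hmy y).aestronglyMeasurable]
    exact ENNReal.toReal_mono hC.ne (h y)

namespace IsBoundedKernel

variable {X Y : Type*} [MeasurableSpace X] [MeasurableSpace Y] {μ : Measure X}
  {κ : Y → X → ℝ} {C : ℝ}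

theorem integrable_mul (h : IsBoundedKernel μ κ C) (u : BoundedMeasurable X) (y : Y) :
    Integrable (fun x => (κ y x : ℂ) * u.1 x) μ :=
  (h.integrable y).ofReal.mul_bdd (measurable_coe u).aestronglyMeasurable
    (ae_of_all _ fun x => norm_apply_le u x)

theorem integrable_mul_norm (h : IsBoundedKernel μ κ C) (u : BoundedMeasurable X) (y : Y) :
    Integrable (fun x => κ y x * ‖u.1 x‖) μ := by
  refine (h.integrable_mul u y).norm.congr (ae_of_all _ fun x => ?_)
  simp [abs_of_nonneg (h.nonneg y x)]

theorem integrable_mul_im (h : IsBoundedKernel μ κ C) (u : BoundedMeasurable X) (y : Y) :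
    Integrable (fun x => κ y x * (u.1 x).im) μ := by
  refine (h.integrable_mul u y).im.congr (ae_of_all _ fun x => ?_)
  simp

theorem norm_integral_mul_le (h : IsBoundedKernel μ κ C) (u : BoundedMeasurable X) (y : Y) :
    ‖∫ x, (κ y x : ℂ) * u.1 x ∂μ‖ ≤ ∫ x, κ y x * ‖u.1 x‖ ∂μ := by
  refine (norm_integral_le_integral_norm _).trans_eq (integral_congr_ae (ae_of_all _ fun x => ?_))
  simp [abs_of_nonneg (h.nonneg y x)]

theorem norm_integral_mul_le_of_forall (h : IsBoundedKernel μ κ C) {u : BoundedMeasurable X}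
    {M : ℝ} (hM : 0 ≤ M) (hu : ∀ x, ‖u.1 x‖ ≤ M) (y : Y) :
    ‖∫ x, (κ y x : ℂ) * u.1 x ∂μ‖ ≤ C * M :=
  calc
    _ ≤ ∫ x, κ y x * ‖u.1 x‖ ∂μ := h.norm_integral_mul_le u y
    _ ≤ ∫ x, κ y x * M ∂μ := integral_mono (h.integrable_mul_norm u y)
        ((h.integrable y).mul_const M) fun x => mul_le_mul_of_nonneg_left (hu x) (h.nonneg y x)
    _ ≤ C * M := by
        rw [integral_mul_const]
        exact mul_le_mul_of_nonneg_right (h.integral_le y) hM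

variable [SFinite μ]

/-- The integral operator with a bounded kernel. -/
noncomputable def op (h : IsBoundedKernel μ κ C) :
    BoundedMeasurable X →L[ℂ] BoundedMeasurable Y :=
  LinearMap.mkContinuous
    { toFun := fun u => ofBounded (fun y => ∫ x, (κ y x : ℂ) * u.1 x ∂μ)
        (StronglyMeasurable.integral_prod_right (f := fun y x => (κ y x : ℂ) * u.1 x)
          ((Complex.measurable_ofReal.comp h.measurable).mul
            ((measurable_coe u).comp measurable_snd)).stronglyMeasurable).measurable
        ⟨C * ‖u‖, h.norm_integral_mul_le_of_forall (norm_nonneg u) (norm_apply_le u)⟩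
      map_add' := fun u v => ext_apply fun y => by
        simp [mul_add, integral_add (h.integrable_mul u y) (h.integrable_mul v y)]
      map_smul' := fun z u => ext_apply fun y => by
        have (x : X) : (κ y x : ℂ) * (z * u.1 x) = z * (κ y x * u.1 x) := by ring
        simp [Algebra.smul_def, this, integral_const_mul] }
    C fun u => norm_le_of_forall (mul_nonneg h.bound_nonneg (norm_nonneg u))
      (h.norm_integral_mul_le_of_forall (norm_nonneg u) (norm_apply_le u))

theorem op_apply (h : IsBoundedKernel μ κ C) (u : BoundedMeasurable X) (y : Y) :
    (h.op u).1 y = ∫ x, (κ y x : ℂ) * u.1 x ∂μ := rfl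

theorem norm_op_apply_le (h : IsBoundedKernel μ κ C) {u : BoundedMeasurable X}
    {M : ℝ} (hM : 0 ≤ M) (hu : ∀ x, ‖u.1 x‖ ≤ M) (y : Y) : ‖(h.op u).1 y‖ ≤ C * M :=
  h.norm_integral_mul_le_of_forall hM hu y

theorem op_apply_im (h : IsBoundedKernel μ κ C) (u : BoundedMeasurable X) (y : Y) :
    ((h.op u).1 y).im = ∫ x, κ y x * (u.1 x).im ∂μ := by
  have := integral_im (h.integrable_mul u y)
  rw [op_apply, ← RCLike.im_eq_complex_im, ← this]
  simp

theorem op_apply_im_nonneg (h : IsBoundedKernel μ κ C) {u : BoundedMeasurable X}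
    (hu : ∀ x, 0 ≤ (u.1 x).im) (y : Y) : 0 ≤ ((h.op u).1 y).im := by
  rw [op_apply_im]
  exact integral_nonneg fun x => mul_nonneg (h.nonneg y x) (hu x)

end IsBoundedKernel

theorem two_mul_mul_le_of_sq_le {x b p q t : ℝ} (hb : 0 ≤ b) (hp : 0 ≤ p) (hq : 0 ≤ q)
    (h : x ^ 2 ≤ b ^ 2 * (p * q)) : 2 * t * x ≤ b * (t ^ 2 * p + q) := by
  refine le_of_sq_le_sq ?_ (by positivity)
  nlinarith [mul_le_mul_of_nonneg_left h (sq_nonneg (2 * t)),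
    mul_nonneg (sq_nonneg b) (sq_nonneg (t ^ 2 * p - q))]

theorem sq_le_of_forall_two_mul_mul_le {x b p q : ℝ} (hx : 0 ≤ x) (hb : 0 ≤ b) (hp : 0 ≤ p)
    (hq : 0 ≤ q) (h : ∀ t, 0 ≤ t → 2 * t * x ≤ b * (t ^ 2 * p + q)) :
    x ^ 2 ≤ b ^ 2 * (p * q) := by
  have key : discrim (b * p) (-2 * x) (b * q) ≤ 0 := by
    refine discrim_le_zero fun t => ?_
    rcases le_total 0 t with ht | ht
    · linarith [h t ht]
    · have h₁ : 0 ≤ b * p * (t * t) := mul_nonneg (mul_nonneg hb hp) (mul_self_nonneg t)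
      have h₂ : 0 ≤ b * q := mul_nonneg hb hq
      nlinarith [mul_nonneg hx (neg_nonneg.2 ht)]
  rw [discrim] at key
  linarith

theorem Complex.neg_inv_im (z : ℂ) : (-z⁻¹).im = z.im / ‖z‖ ^ 2 := by
  rw [Complex.neg_im, Complex.inv_im, Complex.normSq_eq_norm_sq, neg_div, neg_neg]

/-- Two functions with values in the upper half plane are `PickBounded b` if their pointwise
hyperbolic distances are controlled by `b`. -/
def PickBounded {X : Type*} [MeasurableSpace X] (b : ℝ) (u v : BoundedMeasurable X) : Prop :=
  ∀ x, ‖u.1 x - v.1 x‖ ^ 2 ≤ b ^ 2 * ((u.1 x).im * (v.1 x).im)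

/-- The transformation `u ↦ -1 / u`. -/
noncomputable def negInv {X : Type*} [MeasurableSpace X] (u : BoundedMeasurable X) :
    BoundedMeasurable X :=
  -Ring.inverse u

section NegInv

variable {X : Type*} [MeasurableSpace X] {u v : BoundedMeasurable X}

theorem negInv_apply (hu : IsUnit u) (x : X) : (negInv u).1 x = -(u.1 x)⁻¹ := by
  rw [negInv, coe_neg_apply, ringInverse_apply hu]

theorem IsUnit.apply_ne_zero (hu : IsUnit u) (x : X) : u.1 x ≠ 0 := by
  intro h
  have := congrArg (fun w : BoundedMeasurable X => w.1 x) (Ring.mul_inverse_cancel u hu)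
  simp [h] at this

theorem PickBounded.negInv {b : ℝ} (h : PickBounded b u v) (hu : IsUnit u) (hv : IsUnit v) :
    PickBounded b (negInv u) (negInv v) := by
  intro x
  have hu0 := hu.apply_ne_zero x
  have hv0 := hv.apply_ne_zero x
  have hsub : -(u.1 x)⁻¹ - -(v.1 x)⁻¹ = (u.1 x - v.1 x) / (u.1 x * v.1 x) := by
    field_simp
    ring
  rw [negInv_apply hu, negInv_apply hv, Complex.neg_inv_im, Complex.neg_inv_im, hsub, norm_div,
    norm_mul, div_pow, div_mul_div_comm, mul_div_assoc', mul_pow]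
  exact div_le_div_of_nonneg_right (h x) (by positivity)

end NegInv

namespace IsBoundedKernel

variable {X Y : Type*} [MeasurableSpace X] [MeasurableSpace Y] {μ : Measure X} [SFinite μ]
  {κ : Y → X → ℝ} {C : ℝ}

theorem pickBounded_op (h : IsBoundedKernel μ κ C) {b : ℝ} {u v : BoundedMeasurable X}
    (hb : 0 ≤ b) (hu : ∀ x, 0 ≤ (u.1 x).im) (hv : ∀ x, 0 ≤ (v.1 x).im)
    (huv : PickBounded b u v) : PickBounded b (h.op u) (h.op v) := by
  intro y
  refine sq_le_of_forall_two_mul_mul_le (norm_nonneg _) hb (h.op_apply_im_nonneg hu y)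
    (h.op_apply_im_nonneg hv y) fun t ht => ?_
  have hI := ((h.integrable_mul_im u y).const_mul (t ^ 2)).add (h.integrable_mul_im v y)
  calc
    2 * t * ‖(h.op u).1 y - (h.op v).1 y‖
      ≤ 2 * t * ∫ x, κ y x * ‖(u - v).1 x‖ ∂μ := by
        rw [← coe_sub_apply, ← h.op.map_sub]
        exact mul_le_mul_of_nonneg_left (h.norm_integral_mul_le (u - v) y) (by positivity)
    _ = ∫ x, 2 * t * (κ y x * ‖(u - v).1 x‖) ∂μ := (integral_const_mul _ _).symm
    _ ≤ ∫ x, b * (t ^ 2 * (κ y x * (u.1 x).im) + κ y x * (v.1 x).im) ∂μ := by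
        refine integral_mono ((h.integrable_mul_norm (u - v) y).const_mul _) (hI.const_mul b)
          fun x => ?_
        have := mul_le_mul_of_nonneg_left
          (two_mul_mul_le_of_sq_le (t := t) hb (hu x) (hv x) (huv x)) (h.nonneg y x)
        simp only [coe_sub_apply]
        linarith
    _ = b * (t ^ 2 * ((h.op u).1 y).im + ((h.op v).1 y).im) := by
        rw [integral_const_mul, op_apply_im, op_apply_im, ← integral_const_mul (t ^ 2)]
        congr 1
        exact integral_add ((h.integrable_mul_im u y).const_mul (t ^ 2)) (h.integrable_mul_im v y)

/-- A lower bound for `1 + h.op u` when `u` satisfies `η * ‖u‖ ^ 2 ≤ u.im` pointwise. -/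
theorem le_norm_one_add_op_apply (h : IsBoundedKernel μ κ C) {η : ℝ} (hη : 0 < η)
    {u : BoundedMeasurable X} (hu : ∀ x, η * ‖u.1 x‖ ^ 2 ≤ (u.1 x).im) (y : Y) :
    min (1 / 2) (η / (4 * (C + 1))) ≤ ‖1 + (h.op u).1 y‖ := by
  set w := (h.op u).1 y with hw
  have hC := h.bound_nonneg
  set ε := 1 / (4 * (C + 1)) with hε
  have hε0 : 0 < ε := by positivity
  have hεC : ε * C ≤ 1 / 4 := by
    rw [hε, div_mul_eq_mul_div, div_le_iff₀ (by positivity)]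
    linarith
  have hpt (r : ℝ) : 4 * ε * η * r ≤ 4 * ε ^ 2 * η + η * r ^ 2 := by
    nlinarith [mul_nonneg hη.le (sq_nonneg (r - 2 * ε))]
  have hbound : 4 * ε * η * ‖w‖ ≤ 4 * ε ^ 2 * η * C + w.im :=
    calc
      4 * ε * η * ‖w‖ ≤ 4 * ε * η * ∫ x, κ y x * ‖u.1 x‖ ∂μ :=
        mul_le_mul_of_nonneg_left (h.norm_integral_mul_le u y) (by positivity)
      _ = ∫ x, 4 * ε * η * (κ y x * ‖u.1 x‖) ∂μ := (integral_const_mul _ _).symm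
      _ ≤ ∫ x, 4 * ε ^ 2 * η * κ y x + κ y x * (u.1 x).im ∂μ := by
        refine integral_mono ((h.integrable_mul_norm u y).const_mul _)
          (((h.integrable y).const_mul _).add (h.integrable_mul_im u y)) fun x => ?_
        have := mul_le_mul_of_nonneg_left ((hpt ‖u.1 x‖).trans (add_le_add_right (hu x) _))
          (h.nonneg y x)
        simp only
        linarith
      _ = 4 * ε ^ 2 * η * ∫ x, κ y x ∂μ + w.im := by
        rw [integral_add ((h.integrable y).const_mul _) (h.integrable_mul_im u y),
          integral_const_mul, hw, op_apply_im]
      _ ≤ 4 * ε ^ 2 * η * C + w.im := by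
        gcongr
        exact h.integral_le y
  by_cases hhalf : 1 / 2 ≤ ‖1 + w‖
  · exact (min_le_left _ _).trans hhalf
  · refine (min_le_right _ _).trans ?_
    have hw2 : 1 / 2 ≤ ‖w‖ := by
      have := norm_sub_norm_le (1 : ℂ) (-w)
      rw [sub_neg_eq_add, norm_neg, norm_one] at this
      linarith [not_le.1 hhalf]
    have him : w.im ≤ ‖1 + w‖ := by
      simpa using (le_abs_self _).trans (Complex.abs_im_le_norm (1 + w))
    have h₁ : 4 * ε * η * (1 / 2) ≤ 4 * ε * η * ‖w‖ :=
      mul_le_mul_of_nonneg_left hw2 (by positivity)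
    have h₂ : 4 * ε * η * (ε * C) ≤ 4 * ε * η * (1 / 4) :=
      mul_le_mul_of_nonneg_left hεC (by positivity)
    have h₃ : η / (4 * (C + 1)) = ε * η := by
      rw [hε]
      ring
    rw [h₃]
    nlinarith

end IsBoundedKernel

/-- A bound for `-1 / (1 + h.op u)` when `u` satisfies `η * ‖u‖ ^ 2 ≤ u.im` pointwise. -/
noncomputable def innerBound (C η : ℝ) : ℝ := (min (1 / 2) (η / (4 * (C + 1))))⁻¹

section DysonMap

variable {X₁ X₂ : Type*} [MeasurableSpace X₁] [MeasurableSpace X₂] {μ₁ : Measure X₁}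
  {μ₂ : Measure X₂} [SFinite μ₁] [SFinite μ₂] {κ₁ : X₁ → X₂ → ℝ} {κ₂ : X₂ → X₁ → ℝ} {C₁ C₂ : ℝ}
  (hS : IsBoundedKernel μ₂ κ₁ C₁) (hT : IsBoundedKernel μ₁ κ₂ C₂)
  {η R : ℝ} {ζ : ℂ} {u v : BoundedMeasurable X₁}

/-- The denominator `ζ - S (1 / (1 + T u))`. -/
noncomputable def dysonDenom (ζ : ℂ) (u : BoundedMeasurable X₁) : BoundedMeasurable X₁ :=
  algebraMap ℂ _ ζ + hS.op (negInv (1 + hT.op u))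

/-- The map whose fixed points solve the Dyson equation. -/
noncomputable def dysonMap (ζ : ℂ) (u : BoundedMeasurable X₁) : BoundedMeasurable X₁ :=
  negInv (dysonDenom hS hT ζ u)

omit [SFinite μ₁] in
theorem innerBound_pos (hT : IsBoundedKernel μ₁ κ₂ C₂) (hη : 0 < η) : 0 < innerBound C₂ η := by
  have := hT.bound_nonneg
  exact inv_pos.2 (lt_min (by norm_num) (by positivity))

include hT in
theorem isUnit_one_add_op (hη : 0 < η) (hu : ∀ x, η * ‖u.1 x‖ ^ 2 ≤ (u.1 x).im) :
    IsUnit (1 + hT.op u) :=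
  isUnit_of_le_norm (inv_pos.1 (innerBound_pos hT hη)) (hT.le_norm_one_add_op_apply hη hu)

theorem norm_negInv_one_add_op_le (hη : 0 < η) (hu : ∀ x, η * ‖u.1 x‖ ^ 2 ≤ (u.1 x).im) (y : X₂) :
    ‖(negInv (1 + hT.op u)).1 y‖ ≤ innerBound C₂ η := by
  rw [negInv_apply (isUnit_one_add_op hT hη hu), norm_neg, norm_inv]
  exact inv_anti₀ (inv_pos.1 (innerBound_pos hT hη)) (hT.le_norm_one_add_op_apply hη hu y)

theorem im_nonneg_of_mul_sq_le (hη : 0 < η) (hu : ∀ x, η * ‖u.1 x‖ ^ 2 ≤ (u.1 x).im) (x : X₁) :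
    0 ≤ (u.1 x).im :=
  le_trans (by positivity) (hu x)

theorem one_add_op_im_nonneg (hη : 0 < η) (hu : ∀ x, η * ‖u.1 x‖ ^ 2 ≤ (u.1 x).im) (y : X₂) :
    0 ≤ ((1 + hT.op u).1 y).im := by
  rw [coe_add_apply, Complex.add_im, coe_one_apply, Complex.one_im, zero_add]
  exact hT.op_apply_im_nonneg (im_nonneg_of_mul_sq_le hη hu) y

theorem negInv_one_add_op_im_nonneg (hη : 0 < η) (hu : ∀ x, η * ‖u.1 x‖ ^ 2 ≤ (u.1 x).im)
    (y : X₂) : 0 ≤ ((negInv (1 + hT.op u)).1 y).im := by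
  rw [negInv_apply (isUnit_one_add_op hT hη hu), Complex.neg_inv_im]
  exact div_nonneg (one_add_op_im_nonneg hT hη hu y) (sq_nonneg _)

theorem norm_op_negInv_one_add_op_le (hη : 0 < η) (hu : ∀ x, η * ‖u.1 x‖ ^ 2 ≤ (u.1 x).im)
    (x : X₁) : ‖(hS.op (negInv (1 + hT.op u))).1 x‖ ≤ C₁ * innerBound C₂ η :=
  hS.norm_op_apply_le (innerBound_pos hT hη).le (norm_negInv_one_add_op_le hT hη hu) x

theorem norm_dysonDenom_le (hη : 0 < η) (hu : ∀ x, η * ‖u.1 x‖ ^ 2 ≤ (u.1 x).im) (x : X₁) :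
    ‖(dysonDenom hS hT ζ u).1 x‖ ≤ ‖ζ‖ + C₁ * innerBound C₂ η := by
  rw [dysonDenom, coe_add_apply, coe_algebraMap_apply]
  exact (norm_add_le _ _).trans (by gcongr; exact norm_op_negInv_one_add_op_le hS hT hη hu x)

theorem le_dysonDenom_im (hη : 0 < η) (hu : ∀ x, η * ‖u.1 x‖ ^ 2 ≤ (u.1 x).im) (hζ : η ≤ ζ.im)
    (x : X₁) : η ≤ ((dysonDenom hS hT ζ u).1 x).im := by
  rw [dysonDenom, coe_add_apply, coe_algebraMap_apply, Complex.add_im]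
  exact hζ.trans (le_add_of_nonneg_right
    (hS.op_apply_im_nonneg (negInv_one_add_op_im_nonneg hT hη hu) x))

theorem isUnit_dysonDenom (hη : 0 < η) (hu : ∀ x, η * ‖u.1 x‖ ^ 2 ≤ (u.1 x).im)
    (hζ : η ≤ ζ.im) : IsUnit (dysonDenom hS hT ζ u) :=
  isUnit_of_le_norm hη fun x => (le_dysonDenom_im hS hT hη hu hζ x).trans
    ((le_abs_self _).trans (Complex.abs_im_le_norm _))

/-- A set of functions that is invariant under the Dyson map. -/
def dysonDomain (X : Type*) [MeasurableSpace X] (η M : ℝ) : Set (BoundedMeasurable X) :=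
  {u | ∀ x, η * ‖u.1 x‖ ^ 2 ≤ (u.1 x).im ∧ M⁻¹ ≤ ‖u.1 x‖}

theorem isClosed_dysonDomain (η M : ℝ) : IsClosed (dysonDomain X₁ η M) := by
  refine IsSeqClosed.isClosed fun F f hF hf x => ?_
  have hx := tendsto_apply ((continuous_subtype_val.tendsto f).comp hf) x
  exact ⟨le_of_tendsto_of_tendsto' ((hx.norm.pow 2).const_mul η)
    ((Complex.continuous_im.tendsto _).comp hx) fun n => (hF n x).1,
    ge_of_tendsto' hx.norm fun n => (hF n x).2⟩

theorem mem_dysonDomain_of_eq_neg_inv {M : ℝ} (hη : 0 < η) {d : X₁ → ℂ}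
    (h : ∀ x, u.1 x = -(d x)⁻¹) (him : ∀ x, η ≤ (d x).im) (hd : ∀ x, ‖d x‖ ≤ M) :
    u ∈ dysonDomain X₁ η M := by
  intro x
  have hpos : 0 < ‖d x‖ := (hη.trans_le (him x)).trans_le
    ((le_abs_self _).trans (Complex.abs_im_le_norm _))
  rw [h, Complex.neg_inv_im, norm_neg, norm_inv, inv_pow, ← div_eq_mul_inv]
  exact ⟨div_le_div_of_nonneg_right (him x) (sq_nonneg _), inv_anti₀ hpos (hd x)⟩

theorem dysonMap_mem (hη : 0 < η) (hu : ∀ x, η * ‖u.1 x‖ ^ 2 ≤ (u.1 x).im) (hζ : η ≤ ζ.im)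
    (hR : ‖ζ‖ ≤ R) : dysonMap hS hT ζ u ∈ dysonDomain X₁ η (R + C₁ * innerBound C₂ η) :=
  mem_dysonDomain_of_eq_neg_inv hη (negInv_apply (isUnit_dysonDenom hS hT hη hu hζ))
    (le_dysonDenom_im hS hT hη hu hζ)
    fun x => (norm_dysonDenom_le hS hT hη hu x).trans (by gcongr)

theorem mul_le_sq_mul_add_mul_add {M η t p q : ℝ} (hη : 0 < η) (hp : 0 ≤ p) (hq : 0 ≤ q)
    (hpM : p ≤ M) (hqM : q ≤ M) (ht : η ≤ t) :
    p * q ≤ (M / (M + η)) ^ 2 * ((t + p) * (t + q)) := by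
  have hM : 0 ≤ M := hp.trans hpM
  have key {r : ℝ} (hr : r ≤ M) : r ≤ M / (M + η) * (t + r) := by
    rw [div_mul_eq_mul_div, le_div_iff₀ (by positivity)]
    nlinarith [mul_le_mul_of_nonneg_left ht hM]
  calc
    p * q ≤ (M / (M + η) * (t + p)) * (M / (M + η) * (t + q)) :=
      mul_le_mul (key hpM) (key hqM) hq (hp.trans (key hpM))
    _ = _ := by ring

/-- The factor by which the Dyson map contracts hyperbolic distances. -/
noncomputable def contractionFactor (M η : ℝ) : ℝ := M / (M + η)

theorem PickBounded.dysonMap {b : ℝ} (hb : 0 ≤ b) (hη : 0 < η)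
    (hu : ∀ x, η * ‖u.1 x‖ ^ 2 ≤ (u.1 x).im) (hv : ∀ x, η * ‖v.1 x‖ ^ 2 ≤ (v.1 x).im)
    (hζ : η ≤ ζ.im) (h : PickBounded b u v) :
    PickBounded (b * contractionFactor (C₁ * innerBound C₂ η) η)
      (dysonMap hS hT ζ u) (dysonMap hS hT ζ v) := by
  have hT' : PickBounded b (1 + hT.op u) (1 + hT.op v) := fun y => by
    simpa only [coe_add_apply, coe_one_apply, Complex.add_im, Complex.one_im, zero_add,
      add_sub_add_left_eq_sub] using hT.pickBounded_op hb (im_nonneg_of_mul_sq_le hη hu)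
      (im_nonneg_of_mul_sq_le hη hv) h y
  have hS' := hS.pickBounded_op hb (negInv_one_add_op_im_nonneg hT hη hu)
    (negInv_one_add_op_im_nonneg hT hη hv)
    (hT'.negInv (isUnit_one_add_op hT hη hu) (isUnit_one_add_op hT hη hv))
  refine PickBounded.negInv (fun x => ?_) (isUnit_dysonDenom hS hT hη hu hζ)
    (isUnit_dysonDenom hS hT hη hv hζ)
  simp only [dysonDenom, coe_add_apply, coe_algebraMap_apply, Complex.add_im, add_sub_add_left_eq_sub]
  refine (hS' x).trans ?_
  rw [mul_pow, mul_assoc]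
  refine mul_le_mul_of_nonneg_left (mul_le_sq_mul_add_mul_add hη
    (hS.op_apply_im_nonneg (negInv_one_add_op_im_nonneg hT hη hu) x)
    (hS.op_apply_im_nonneg (negInv_one_add_op_im_nonneg hT hη hv) x) ?_ ?_ hζ) (sq_nonneg b)
  · exact ((le_abs_self _).trans (Complex.abs_im_le_norm _)).trans
      (norm_op_negInv_one_add_op_le hS hT hη hu x)
  · exact ((le_abs_self _).trans (Complex.abs_im_le_norm _)).trans
      (norm_op_negInv_one_add_op_le hS hT hη hv x)

theorem pickBounded_of_mem {M : ℝ} (hη : 0 < η) (hM : 0 < M) (hu : u ∈ dysonDomain X₁ η M)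
    (hv : v ∈ dysonDomain X₁ η M) : PickBounded (‖u - v‖ * (M ^ 2 / η)) u v := by
  intro x
  have him {w : BoundedMeasurable X₁} (hw : w ∈ dysonDomain X₁ η M) :
      η / M ^ 2 ≤ (w.1 x).im := by
    refine le_trans ?_ (hw x).1
    rw [div_eq_mul_inv, ← inv_pow]
    have := (hw x).2
    gcongr
  calc
    ‖u.1 x - v.1 x‖ ^ 2 ≤ ‖u - v‖ ^ 2 := by
      have := norm_apply_le (u - v) x
      rw [coe_sub_apply] at this
      gcongr
    _ = (‖u - v‖ * (M ^ 2 / η)) ^ 2 * (η / M ^ 2 * (η / M ^ 2)) := by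
      field_simp
    _ ≤ _ := by
      have hle := him hu
      have hle' := him hv
      have : 0 ≤ η / M ^ 2 := by positivity
      exact mul_le_mul_of_nonneg_left (mul_le_mul hle hle' this (this.trans hle)) (sq_nonneg _)

theorem PickBounded.norm_sub_le {b M : ℝ} (hη : 0 < η) (hb : 0 ≤ b) (h : PickBounded b u v)
    (hu : u ∈ dysonDomain X₁ η M) (hv : v ∈ dysonDomain X₁ η M) : ‖u - v‖ ≤ b / η := by
  refine norm_le_of_forall (by positivity) fun x => ?_
  have him {w : BoundedMeasurable X₁} (hw : w ∈ dysonDomain X₁ η M) :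
      0 ≤ (w.1 x).im ∧ (w.1 x).im ≤ 1 / η := by
    have h₀ := im_nonneg_of_mul_sq_le hη (fun y => (hw y).1) x
    refine ⟨h₀, ?_⟩
    rw [le_div_iff₀ hη]
    by_contra! hlt
    have h₁ : (w.1 x).im ≤ ‖w.1 x‖ := (le_abs_self _).trans (Complex.abs_im_le_norm _)
    have h₂ := (hw x).1
    have h₃ : (w.1 x).im ^ 2 ≤ ‖w.1 x‖ ^ 2 := by gcongr
    have h₄ : 0 < (w.1 x).im := pos_of_mul_pos_left (one_pos.trans hlt) hη.le
    nlinarith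
  rw [coe_sub_apply]
  refine le_of_sq_le_sq ((h x).trans ?_) (by positivity)
  calc
    b ^ 2 * ((u.1 x).im * (v.1 x).im) ≤ b ^ 2 * (1 / η * (1 / η)) := by
      gcongr
      · exact (him hv).1
      · exact (him hu).2
      · exact (him hv).2
    _ = (b / η) ^ 2 := by ring

theorem norm_sub_le_of_mem {M : ℝ} (hη : 0 < η) (hu : u ∈ dysonDomain X₁ η M)
    (hv : v ∈ dysonDomain X₁ η M) : ‖u - v‖ ≤ 2 / η := by
  have hle {w : BoundedMeasurable X₁} (hw : w ∈ dysonDomain X₁ η M) : ‖w‖ ≤ 1 / η := by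
    refine norm_le_of_forall (by positivity) fun x => ?_
    have h₁ := (hw x).1.trans ((le_abs_self _).trans (Complex.abs_im_le_norm _))
    rw [le_div_iff₀ hη]
    by_contra! hlt
    have : 0 < ‖w.1 x‖ := pos_of_mul_pos_left (one_pos.trans hlt) hη.le
    nlinarith
  calc
    ‖u - v‖ ≤ ‖u‖ + ‖v‖ := norm_sub_le u v
    _ ≤ 1 / η + 1 / η := add_le_add (hle hu) (hle hv)
    _ = 2 / η := by ring

section Iteration

omit [SFinite μ₁] [SFinite μ₂] in
include hS hT in
theorem dysonBound_nonneg (hη : 0 < η) : 0 ≤ C₁ * innerBound C₂ η :=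
  mul_nonneg hS.bound_nonneg (innerBound_pos hT hη).le

theorem contractionFactor_nonneg {M : ℝ} (hM : 0 ≤ M) (hη : 0 < η) :
    0 ≤ contractionFactor M η :=
  div_nonneg hM (by positivity)

theorem contractionFactor_lt_one {M : ℝ} (hM : 0 ≤ M) (hη : 0 < η) :
    contractionFactor M η < 1 := by
  rw [contractionFactor, div_lt_one (by positivity)]
  linarith

theorem iterate_dysonMap_mem (hη : 0 < η) (hζ : η ≤ ζ.im) (hR : ‖ζ‖ ≤ R)
    (hu : u ∈ dysonDomain X₁ η (R + C₁ * innerBound C₂ η)) (n : ℕ) :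
    (dysonMap hS hT ζ)^[n] u ∈ dysonDomain X₁ η (R + C₁ * innerBound C₂ η) := by
  induction n with
  | zero => exact hu
  | succ n ih =>
    rw [Function.iterate_succ_apply']
    exact dysonMap_mem hS hT hη (fun x => (ih x).1) hζ hR

theorem PickBounded.iterate_dysonMap {b : ℝ} (hb : 0 ≤ b) (hη : 0 < η) (hζ : η ≤ ζ.im)
    (hR : ‖ζ‖ ≤ R) (hu : u ∈ dysonDomain X₁ η (R + C₁ * innerBound C₂ η))
    (hv : v ∈ dysonDomain X₁ η (R + C₁ * innerBound C₂ η)) (h : PickBounded b u v) (n : ℕ) :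
    PickBounded (b * contractionFactor (C₁ * innerBound C₂ η) η ^ n)
      ((_root_.dysonMap hS hT ζ)^[n] u) ((_root_.dysonMap hS hT ζ)^[n] v) := by
  induction n with
  | zero => simpa using h
  | succ n ih =>
    rw [Function.iterate_succ_apply', Function.iterate_succ_apply', pow_succ, ← mul_assoc]
    have := contractionFactor_nonneg (dysonBound_nonneg hS hT hη) hη
    exact PickBounded.dysonMap hS hT (by positivity) hη
      (fun x => (iterate_dysonMap_mem hS hT hη hζ hR hu n x).1)
      (fun x => (iterate_dysonMap_mem hS hT hη hζ hR hv n x).1) hζ ih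

theorem norm_iterate_dysonMap_sub_le (hη : 0 < η) (hζ : η ≤ ζ.im) (hR : ‖ζ‖ ≤ R)
    (hu : u ∈ dysonDomain X₁ η (R + C₁ * innerBound C₂ η))
    (hv : v ∈ dysonDomain X₁ η (R + C₁ * innerBound C₂ η)) (n : ℕ) :
    ‖(dysonMap hS hT ζ)^[n] u - (dysonMap hS hT ζ)^[n] v‖ ≤
      (R + C₁ * innerBound C₂ η) ^ 2 / η / η * ‖u - v‖ *
        contractionFactor (C₁ * innerBound C₂ η) η ^ n := by
  have hM := dysonBound_nonneg hS hT hη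
  have hθ := contractionFactor_nonneg hM hη
  have hRM : 0 < R + C₁ * innerBound C₂ η :=
    add_pos_of_pos_of_nonneg ((hη.trans_le hζ).trans_le
      (((le_abs_self _).trans (Complex.abs_im_le_norm ζ)).trans hR)) hM
  refine (((pickBounded_of_mem hη hRM hu hv).iterate_dysonMap hS hT (by positivity) hη hζ hR hu hv
    n).norm_sub_le hη (by positivity) (iterate_dysonMap_mem hS hT hη hζ hR hu n)
    (iterate_dysonMap_mem hS hT hη hζ hR hv n)).trans_eq ?_
  ring

/-- The starting point `-1 / ζ` of the fixed point iteration. -/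
noncomputable def dysonStart (X : Type*) [MeasurableSpace X] (ζ : ℂ) : BoundedMeasurable X :=
  algebraMap ℂ _ (-ζ⁻¹)

theorem dysonStart_mem {M : ℝ} (hη : 0 < η) (hζ : η ≤ ζ.im) (hR : ‖ζ‖ ≤ R) (hM : 0 ≤ M) :
    dysonStart X₁ ζ ∈ dysonDomain X₁ η (R + M) :=
  mem_dysonDomain_of_eq_neg_inv (d := fun _ => ζ) hη (coe_algebraMap_apply (-ζ⁻¹)) (fun _ => hζ)
    fun _ => hR.trans (le_add_of_nonneg_right hM)

/-- The solution of the Dyson equation, as the limit of the fixed point iteration. -/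
noncomputable def dysonSolution (ζ : ℂ) : BoundedMeasurable X₁ :=
  limUnder atTop fun n => (dysonMap hS hT ζ)^[n] (dysonStart X₁ ζ)

theorem dist_iterate_dysonMap_succ_le (hη : 0 < η) (hζ : η ≤ ζ.im) (hR : ‖ζ‖ ≤ R) (n : ℕ) :
    dist ((dysonMap hS hT ζ)^[n] (dysonStart X₁ ζ)) ((dysonMap hS hT ζ)^[n + 1] (dysonStart X₁ ζ))
      ≤ (R + C₁ * innerBound C₂ η) ^ 2 / η / η * (2 / η) *
        contractionFactor (C₁ * innerBound C₂ η) η ^ n := by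
  have hM := dysonBound_nonneg hS hT hη
  have hθ := contractionFactor_nonneg hM hη
  have h₀ := dysonStart_mem (X₁ := X₁) hη hζ hR hM
  have h₁ := dysonMap_mem hS hT hη (fun x => (h₀ x).1) hζ hR
  rw [dist_eq_norm, Function.iterate_succ_apply]
  refine (norm_iterate_dysonMap_sub_le hS hT hη hζ hR h₀ h₁ n).trans ?_
  have := norm_sub_le_of_mem hη h₀ h₁
  gcongr

theorem tendsto_dysonSolution (hζ : 0 < ζ.im) :
    Tendsto (fun n => (dysonMap hS hT ζ)^[n] (dysonStart X₁ ζ)) atTop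
      (𝓝 (dysonSolution hS hT ζ)) :=
  (cauchySeq_of_le_geometric _ _
    (contractionFactor_lt_one (dysonBound_nonneg hS hT hζ) hζ)
    (dist_iterate_dysonMap_succ_le hS hT hζ le_rfl le_rfl)).tendsto_limUnder

theorem tendstoUniformlyOn_dysonSolution (hη : 0 < η) :
    TendstoUniformlyOn (fun n ζ => (dysonMap hS hT ζ)^[n] (dysonStart X₁ ζ))
      (dysonSolution hS hT) atTop {ζ | η < ζ.im ∧ ‖ζ‖ < R} := by
  have hM := dysonBound_nonneg hS hT hη
  have hθ := contractionFactor_lt_one hM hη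
  have hlim := ((tendsto_pow_atTop_nhds_zero_of_lt_one (contractionFactor_nonneg hM hη)
    hθ).const_mul ((R + C₁ * innerBound C₂ η) ^ 2 / η / η * (2 / η))).div_const
      (1 - contractionFactor (C₁ * innerBound C₂ η) η)
  rw [mul_zero, zero_div] at hlim
  refine Metric.tendstoUniformlyOn_iff.2 fun ε hε => ?_
  filter_upwards [hlim.eventually_lt_const hε] with n hn ζ hζ
  rw [dist_comm]
  exact (dist_le_of_le_geometric_of_tendsto _ _ hθ
    (dist_iterate_dysonMap_succ_le hS hT hη hζ.1.le hζ.2.le)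
    (tendsto_dysonSolution hS hT (hη.trans hζ.1)) n).trans_lt hn

theorem dysonSolution_mem (hζ : 0 < ζ.im) :
    dysonSolution hS hT ζ ∈ dysonDomain X₁ ζ.im (‖ζ‖ + C₁ * innerBound C₂ ζ.im) :=
  (isClosed_dysonDomain _ _).mem_of_tendsto (tendsto_dysonSolution hS hT hζ)
    (Eventually.of_forall (iterate_dysonMap_mem hS hT hζ le_rfl le_rfl
      (dysonStart_mem hζ le_rfl le_rfl (dysonBound_nonneg hS hT hζ))))

theorem dysonMap_dysonSolution (hζ : 0 < ζ.im) :
    dysonMap hS hT ζ (dysonSolution hS hT ζ) = dysonSolution hS hT ζ := by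
  have hlim := tendsto_dysonSolution hS hT hζ
  refine tendsto_nhds_unique (f := fun n => (dysonMap hS hT ζ)^[n + 1] (dysonStart X₁ ζ)) ?_
    (hlim.comp (tendsto_add_atTop_nat 1))
  have h₀ := (tendsto_iff_norm_sub_tendsto_zero.1 hlim).const_mul
    ((‖ζ‖ + C₁ * innerBound C₂ ζ.im) ^ 2 / ζ.im / ζ.im)
  have h₁ := h₀.mul_const (contractionFactor (C₁ * innerBound C₂ ζ.im) ζ.im ^ 1)
  rw [mul_zero, zero_mul] at h₁
  refine tendsto_iff_norm_sub_tendsto_zero.2 (squeeze_zero (fun _ => norm_nonneg _)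
    (fun n => ?_) h₁)
  rw [Function.iterate_succ_apply']
  exact norm_iterate_dysonMap_sub_le hS hT hζ le_rfl le_rfl
    (iterate_dysonMap_mem hS hT hζ le_rfl le_rfl
      (dysonStart_mem hζ le_rfl le_rfl (dysonBound_nonneg hS hT hζ)) n)
    (dysonSolution_mem hS hT hζ) 1

theorem eq_dysonSolution (hζ : 0 < ζ.im)
    (hu : u ∈ dysonDomain X₁ ζ.im (‖ζ‖ + C₁ * innerBound C₂ ζ.im))
    (hfix : dysonMap hS hT ζ u = u) : u = dysonSolution hS hT ζ := by
  have hM := dysonBound_nonneg hS hT hζ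
  have hlim := (tendsto_pow_atTop_nhds_zero_of_lt_one (contractionFactor_nonneg hM hζ)
    (contractionFactor_lt_one hM hζ)).const_mul ((‖ζ‖ + C₁ * innerBound C₂ ζ.im) ^ 2 / ζ.im / ζ.im *
      ‖u - dysonSolution hS hT ζ‖)
  rw [mul_zero] at hlim
  refine sub_eq_zero.1 (norm_le_zero_iff.1 (ge_of_tendsto' hlim fun n => ?_))
  have := norm_iterate_dysonMap_sub_le hS hT hζ le_rfl le_rfl hu (dysonSolution_mem hS hT hζ) n
  rwa [Function.iterate_fixed hfix, Function.iterate_fixed (dysonMap_dysonSolution hS hT hζ)]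
    at this

theorem differentiableAt_dysonMap {f : ℂ → BoundedMeasurable X₁} (hη : 0 < η) (hζ : η ≤ ζ.im)
    (hf : DifferentiableAt ℂ f ζ) (hu : ∀ x, η * ‖(f ζ).1 x‖ ^ 2 ≤ ((f ζ).1 x).im) :
    DifferentiableAt ℂ (fun z => dysonMap hS hT z (f z)) ζ := by
  have h₁ : DifferentiableAt ℂ (fun z => negInv (1 + hT.op (f z))) ζ :=
    (((hT.op.differentiableAt.comp ζ hf).const_add 1).inverse (isUnit_one_add_op hT hη hu)).neg
  have h₂ : DifferentiableAt ℂ (fun z => dysonDenom hS hT z (f z)) ζ :=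
    (algebraMapCLM ℂ (BoundedMeasurable X₁)).differentiableAt.add
      (hS.op.differentiableAt.comp ζ h₁)
  exact (h₂.inverse (isUnit_dysonDenom hS hT hη hu hζ)).neg

theorem differentiableAt_iterate_dysonMap (hζ : 0 < ζ.im) (n : ℕ) :
    DifferentiableAt ℂ (fun z => (dysonMap hS hT z)^[n] (dysonStart X₁ z)) ζ := by
  induction n with
  | zero =>
    have hne : ζ ≠ 0 := by
      rintro rfl
      simp at hζ
    simp only [Function.iterate_zero, id, dysonStart, Algebra.algebraMap_eq_smul_one]
    exact (differentiableAt_inv hne).neg.smul_const (1 : BoundedMeasurable X₁)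
  | succ n ih =>
    simp only [Function.iterate_succ_apply']
    exact differentiableAt_dysonMap hS hT hζ le_rfl ih fun x => (iterate_dysonMap_mem hS hT hζ
      le_rfl le_rfl (dysonStart_mem hζ le_rfl le_rfl (dysonBound_nonneg hS hT hζ)) n x).1

theorem analyticAt_dysonSolution (hζ : 0 < ζ.im) : AnalyticAt ℂ (dysonSolution hS hT) ζ := by
  have hopen : IsOpen {z : ℂ | ζ.im / 2 < z.im ∧ ‖z‖ < ‖ζ‖ + 1} :=
    (isOpen_lt continuous_const Complex.continuous_im).inter
      (isOpen_lt continuous_norm continuous_const)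
  have hdiff := (tendstoUniformlyOn_dysonSolution hS hT (R := ‖ζ‖ + 1)
    (half_pos hζ)).tendstoLocallyUniformlyOn.differentiableOn (Eventually.of_forall fun n z hz =>
      (differentiableAt_iterate_dysonMap hS hT
        ((half_pos hζ).trans hz.1) n).differentiableWithinAt) hopen
  exact hdiff.analyticAt (hopen.mem_nhds ⟨half_lt_self hζ, lt_add_one _⟩)

end Iteration

theorem dysonDenom_apply (hη : 0 < η) (hu : ∀ x, η * ‖u.1 x‖ ^ 2 ≤ (u.1 x).im) (x : X₁) :
    (dysonDenom hS hT ζ u).1 x =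
      ζ - ∫ r, (κ₁ x r : ℂ) * (1 + ∫ l, (κ₂ r l : ℂ) * u.1 l ∂μ₁)⁻¹ ∂μ₂ := by
  rw [dysonDenom, coe_add_apply, coe_algebraMap_apply, hS.op_apply, sub_eq_add_neg,
    ← integral_neg]
  congr 1
  refine integral_congr_ae (ae_of_all _ fun r => ?_)
  simp only [negInv_apply (isUnit_one_add_op hT hη hu), mul_neg, coe_add_apply, coe_one_apply,
    hT.op_apply]

omit [SFinite μ₁] in
theorem integral_im_nonpos {f : X₁ → ℂ} (hf : ∀ x, (f x).im ≤ 0) : (∫ x, f x ∂μ₁).im ≤ 0 := by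
  by_cases hi : Integrable f μ₁
  · rw [← RCLike.im_eq_complex_im, ← integral_im hi]
    exact integral_nonpos hf
  · simp [integral_undef hi]

omit [SFinite μ₂] in
include hS hT in
theorem mul_sq_le_im_of_dyson (hu : ∀ x, 0 < (u.1 x).im)
    (h : ∀ x, -(u.1 x)⁻¹ =
      ζ - ∫ r, (κ₁ x r : ℂ) * (1 + ∫ l, (κ₂ r l : ℂ) * u.1 l ∂μ₁)⁻¹ ∂μ₂) (x : X₁) :
    ζ.im * ‖u.1 x‖ ^ 2 ≤ (u.1 x).im := by
  have hI : (∫ r, (κ₁ x r : ℂ) * (1 + ∫ l, (κ₂ r l : ℂ) * u.1 l ∂μ₁)⁻¹ ∂μ₂).im ≤ 0 := by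
    refine integral_im_nonpos fun r => ?_
    rw [Complex.im_ofReal_mul, Complex.inv_im, ← hT.op_apply]
    refine mul_nonpos_of_nonneg_of_nonpos (hS.nonneg x r)
      (div_nonpos_of_nonpos_of_nonneg ?_ (Complex.normSq_nonneg _))
    simpa using hT.op_apply_im_nonneg (fun x => (hu x).le) r
  have hx : ζ.im ≤ (-(u.1 x)⁻¹).im := by
    rw [h, Complex.sub_im]
    linarith
  have hpos : 0 < ‖u.1 x‖ := (hu x).trans_le ((le_abs_self _).trans (Complex.abs_im_le_norm _))
  rwa [Complex.neg_inv_im, le_div_iff₀ (by positivity)] at hx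

theorem eq_dysonSolution_of_dyson (hζ : 0 < ζ.im) (hu : ∀ x, 0 < (u.1 x).im)
    (h : ∀ x, -(u.1 x)⁻¹ =
      ζ - ∫ r, (κ₁ x r : ℂ) * (1 + ∫ l, (κ₂ r l : ℂ) * u.1 l ∂μ₁)⁻¹ ∂μ₂) :
    u = dysonSolution hS hT ζ := by
  have hle := mul_sq_le_im_of_dyson hS hT hu h
  have hfix : dysonMap hS hT ζ u = u := ext_apply fun x => by
    rw [dysonMap, negInv_apply (isUnit_dysonDenom hS hT hζ hle le_rfl),
      dysonDenom_apply hS hT hζ hle, ← h, inv_neg, inv_inv, neg_neg]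
  exact eq_dysonSolution hS hT hζ (hfix ▸ dysonMap_mem hS hT hζ hle le_rfl le_rfl) hfix

end DysonMap

/-- Existence, uniqueness and analyticity for the Dyson equation.
Assuming only the two integrability bounds on the kernel `s`, there is exactly one
function `m : ℍ → B₁` (realized as a map `ℂ → lp (fun _ : X₁ => ℂ) ∞` into the Banach space
of bounded functions on `X₁`, with bounded *measurable* values, considered on the upper half
plane) such that for every `ζ` with `Im ζ > 0`: `m(ζ)` vanishes nowhere, `1 + Sᵗm(ζ)` vanishes
nowhere, the Dyson equation `−1/m(ζ) = ζ − S(1/(1 + Sᵗ m(ζ)))` holds pointwise on `X₁`, and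
`Im m(ζ) > 0` pointwise.  Moreover this function is analytic on the upper half plane. -/
theorem stmt_0 {X₁ X₂ : Type*} [MeasurableSpace X₁] [MeasurableSpace X₂]
    (π₁ : Measure X₁) (π₂ : Measure X₂) [IsFiniteMeasure π₁] [IsFiniteMeasure π₂]
    (hπ₁ : 0 < π₁ Set.univ) (hπ₂ : 0 < π₂ Set.univ)
    (s : X₁ → X₂ → ℝ) (hs_meas : Measurable (Function.uncurry s))
    (hs_nonneg : ∀ k q, 0 ≤ s k q)
    (hs_row : ∃ C : ℝ≥0∞, C < ⊤ ∧ ∀ k, ∫⁻ q, ENNReal.ofReal (s k q) ∂π₂ ≤ C)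
    (hs_col : ∃ C : ℝ≥0∞, C < ⊤ ∧ ∀ q, ∫⁻ k, ENNReal.ofReal (s k q) ∂π₁ ≤ C)
    -- the defining property of a solution of the Dyson equation on `ℍ`
    (P : (ℂ → lp (fun _ : X₁ => ℂ) ∞) → Prop)
    (hP : P = fun m => ∀ ζ : ℂ, 0 < ζ.im →
      Measurable (fun k => m ζ k) ∧
      (∀ k, m ζ k ≠ 0) ∧
      (∀ q : X₂, (1 : ℂ) + ∫ l, (s l q : ℂ) * m ζ l ∂π₁ ≠ 0) ∧
      (∀ k, -(m ζ k)⁻¹ =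
        ζ - ∫ r, (s k r : ℂ) * ((1 : ℂ) + ∫ l, (s l r : ℂ) * m ζ l ∂π₁)⁻¹ ∂π₂) ∧
      (∀ k, 0 < (m ζ k).im)) :
    ∃ m : ℂ → lp (fun _ : X₁ => ℂ) ∞,
      P m ∧ AnalyticOnNhd ℂ m {ζ : ℂ | 0 < ζ.im} ∧
        ∀ m' : ℂ → lp (fun _ : X₁ => ℂ) ∞, P m' →
          ∀ ζ : ℂ, 0 < ζ.im → m' ζ = m ζ := by
  subst hP
  obtain ⟨C₁, hS⟩ := exists_isBoundedKernel hs_meas hs_nonneg hs_row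
  obtain ⟨C₂, hT⟩ := exists_isBoundedKernel (κ := fun q k => s k q)
    (hs_meas.comp measurable_swap) (fun q k => hs_nonneg k q) hs_col
  refine ⟨fun ζ => (dysonSolution hS hT ζ).1, fun ζ hζ => ?_, fun ζ hζ => ?_,
    fun m' hm' ζ hζ => ?_⟩
  · have hle := fun k => (dysonSolution_mem hS hT hζ k).1
    have happly (k : X₁) : (dysonSolution hS hT ζ).1 k =
        -((dysonDenom hS hT ζ (dysonSolution hS hT ζ)).1 k)⁻¹ := by
      rw [← negInv_apply (isUnit_dysonDenom hS hT hζ hle le_rfl)]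
      exact congrArg (fun u : BoundedMeasurable X₁ => u.1 k) (dysonMap_dysonSolution hS hT hζ).symm
    have hne (k : X₁) : (dysonSolution hS hT ζ).1 k ≠ 0 := by
      rw [happly]
      exact neg_ne_zero.2 (inv_ne_zero
        ((isUnit_dysonDenom hS hT hζ hle le_rfl).apply_ne_zero k))
    refine ⟨measurable_coe _, hne, (isUnit_one_add_op hT hζ hle).apply_ne_zero, fun k => ?_,
      fun k => ?_⟩
    · rw [happly, inv_neg, inv_inv, neg_neg]
      exact dysonDenom_apply hS hT hζ hle k
    · exact (mul_pos hζ (pow_pos (norm_pos_iff.2 (hne k)) 2)).trans_le (hle k)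
  · exact ((toLp (X := X₁)).analyticAt _).comp
      (analyticAt_dysonSolution hS hT hζ)
  · obtain ⟨hmeas, -, -, heq, him⟩ := hm' ζ hζ
    exact congrArg Subtype.val
      (eq_dysonSolution_of_dyson hS hT (u := ⟨m' ζ, hmeas⟩) hζ him heq)
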